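/- arXiv:1502.07219 — 4 statements merged into one kernel-verified Lean document; each statement's English description precedes it below -/
import Mathlib

section
/- Let n ∈ ℕ and let A be an n × n real matrix that is symmetric and positive definite. Then the graph of iA, namely the ℂ-subspace {(v, i·(Av)) : v ∈ ℂⁿ} of ℂⁿ × ℂⁿ (where A acts on ℂⁿ via its complexification), is a positive Lagrangian subspace of ℂⁿ × ℂⁿ with respect to the complex hyperbolic form Ω and componentwise complex conjugation. -/
open scoped BigOperators

/-- The complex hyperbolic form on `ℂⁿ × ℂⁿ`:
`Ω((v₁⁺,v₁⁻),(v₂⁺,v₂⁻)) = ∑ᵢ (v₁⁺)ᵢ(v₂⁻)ᵢ − ∑ᵢ (v₂⁺)ᵢ(v₁⁻)ᵢ`. -/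
noncomputable def hypForm (n : ℕ) (v w : (Fin n → ℂ) × (Fin n → ℂ)) : ℂ :=
  (∑ i, v.1 i * w.2 i) - (∑ i, w.1 i * v.2 i)

/-- Componentwise complex conjugation on `ℂⁿ × ℂⁿ`. -/
noncomputable def conjPair (n : ℕ) (v : (Fin n → ℂ) × (Fin n → ℂ)) :
    (Fin n → ℂ) × (Fin n → ℂ) :=
  (fun i => (starRingEnd ℂ) (v.1 i), fun i => (starRingEnd ℂ) (v.2 i))

/-- `L` is a positive Lagrangian subspace with respect to the bilinear form `Ω` and the
conjugation `conj`. -/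
def IsPosLagrangian {V : Type*} [AddCommGroup V] [Module ℂ V]
    (Ω : V → V → ℂ) (conj : V → V) (L : Submodule ℂ V) : Prop :=
  (∀ v ∈ L, ∀ w ∈ L, Ω v w = 0) ∧
  (∀ v : V, (∀ w ∈ L, Ω v w = 0) → v ∈ L) ∧
  (∀ v ∈ L, v ≠ 0 →
    0 < (-Complex.I * Ω (conj v) v).re ∧ (-Complex.I * Ω (conj v) v).im = 0)

theorem hypForm_eq_dotProduct (n : ℕ) (v w : (Fin n → ℂ) × (Fin n → ℂ)) :
    hypForm n v w = v.1 ⬝ᵥ w.2 - w.1 ⬝ᵥ v.2 := rfl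

theorem conjPair_eq_star (n : ℕ) (v : (Fin n → ℂ) × (Fin n → ℂ)) :
    conjPair n v = star v := rfl

/-- A symmetric matrix is self-adjoint for the bilinear dot product. -/
theorem Matrix.IsSymm.dotProduct_mulVec_comm {m R : Type*} [Fintype m] [CommSemiring R]
    {M : Matrix m m R} (hM : M.IsSymm) (x y : m → R) :
    x ⬝ᵥ M.mulVec y = y ⬝ᵥ M.mulVec x := by
  rw [Matrix.dotProduct_mulVec, ← Matrix.mulVec_transpose, hM.eq, dotProduct_comm]

/-- The graph of a symmetric matrix contains its own orthogonal complement. -/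
theorem mem_graph_of_forall_hypForm_eq_zero {n : ℕ} {M : Matrix (Fin n) (Fin n) ℂ}
    (hM : M.IsSymm) (v : (Fin n → ℂ) × (Fin n → ℂ))
    (hv : ∀ w ∈ LinearMap.graph M.mulVecLin, hypForm n v w = 0) :
    v ∈ LinearMap.graph M.mulVecLin := by
  rw [LinearMap.mem_graph_iff, Matrix.mulVecLin_apply]
  refine (dotProduct_eq _ _ fun y => ?_)
  have h := hv (y, M.mulVec y) (by simp [LinearMap.mem_graph_iff])
  rw [hypForm_eq_dotProduct, hM.dotProduct_mulVec_comm, sub_eq_zero] at h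
  rw [dotProduct_comm, ← h, dotProduct_comm]

theorem Matrix.IsHermitian.map_complex_ofReal {m : Type*} {A : Matrix m m ℝ}
    (hA : A.IsHermitian) : (A.map Complex.ofReal).IsHermitian :=
  hA.map _ fun _ => by simp

/-- The complexification of a positive definite real matrix is positive definite. -/
theorem Matrix.PosDef.re_star_dotProduct_map_ofReal_mulVec_pos {m : Type*} [Fintype m]
    {A : Matrix m m ℝ} (hA : A.PosDef) {x : m → ℂ} (hx : x ≠ 0) :
    0 < (star x ⬝ᵥ (A.map Complex.ofReal).mulVec x).re := by
  set a : m → ℝ := fun i => (x i).re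
  set b : m → ℝ := fun i => (x i).im
  have hre : (star x ⬝ᵥ (A.map Complex.ofReal).mulVec x).re =
      a ⬝ᵥ A.mulVec a + b ⬝ᵥ A.mulVec b := by
    simp [dotProduct, Matrix.mulVec, a, b, Finset.sum_add_distrib]
  rw [hre]
  have nonneg (c : m → ℝ) : 0 ≤ c ⬝ᵥ A.mulVec c := by
    simpa using hA.posSemidef.dotProduct_mulVec_nonneg c
  have pos (c : m → ℝ) (hc : c ≠ 0) : 0 < c ⬝ᵥ A.mulVec c := by
    simpa using hA.dotProduct_mulVec_pos hc
  by_cases ha : a = 0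
  · have hb : b ≠ 0 := fun hb => hx <| funext fun i =>
      Complex.ext (congrFun ha i) (congrFun hb i)
    exact add_pos_of_nonneg_of_pos (nonneg a) (pos b hb)
  · exact add_pos_of_pos_of_nonneg (pos a ha) (nonneg b)

/-- If `A` is a symmetric positive definite real `n × n` matrix, then the graph of `iA`,
i.e. `{(v, i·(Av)) : v ∈ ℂⁿ}` (with `A` acting via its complexification), is a positive
Lagrangian subspace of `ℂⁿ × ℂⁿ` for the complex hyperbolic form and componentwise
conjugation. -/
theorem posLagrangian_graph_I_smul (n : ℕ) (A : Matrix (Fin n) (Fin n) ℝ)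
    (hsymm : A.IsSymm) (hpos : A.PosDef) :
    IsPosLagrangian (hypForm n) (conjPair n)
      (LinearMap.graph (Matrix.mulVecLin (Complex.I • A.map Complex.ofReal))) := by
  have hM : (Complex.I • A.map Complex.ofReal).IsSymm := (hsymm.map _).smul _
  refine ⟨?_, mem_graph_of_forall_hypForm_eq_zero hM, ?_⟩
  · rintro ⟨x, x'⟩ hx ⟨y, y'⟩ hy
    rw [LinearMap.mem_graph_iff, Matrix.mulVecLin_apply] at hx hy
    dsimp only at hx hy
    subst hx hy
    rw [hypForm_eq_dotProduct, sub_eq_zero]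
    exact hM.dotProduct_mulVec_comm x y
  · rintro ⟨x, x'⟩ hx hne
    rw [LinearMap.mem_graph_iff, Matrix.mulVecLin_apply] at hx
    dsimp only at hx
    subst hx
    have hx0 : x ≠ 0 := by
      rintro rfl
      simp at hne
    have hB := hpos.isHermitian.map_complex_ofReal
    have hre := hpos.re_star_dotProduct_map_ofReal_mulVec_pos hx0
    have him : (star x ⬝ᵥ (A.map Complex.ofReal).mulVec x).im = 0 :=
      hB.im_star_dotProduct_mulVec_self x
    have hherm : x ⬝ᵥ star ((A.map Complex.ofReal).mulVec x) =
        star x ⬝ᵥ (A.map Complex.ofReal).mulVec x := by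
      rw [Matrix.star_mulVec, hB.eq, dotProduct_comm, Matrix.dotProduct_mulVec]
    set q := star x ⬝ᵥ (A.map Complex.ofReal).mulVec x with hqdef
    have key : -Complex.I * hypForm n
        (conjPair n (x, (Complex.I • A.map Complex.ofReal).mulVec x))
        (x, (Complex.I • A.map Complex.ofReal).mulVec x) = 2 * q := by
      rw [hypForm_eq_dotProduct, conjPair_eq_star]
      simp only [Prod.fst_star, Prod.snd_star, Matrix.smul_mulVec, star_smul, dotProduct_smul,
        hherm, ← hqdef, smul_eq_mul, Complex.star_def, Complex.conj_I]
      linear_combination (-2 * q) * Complex.I_mul_I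
    rw [key]
    constructor <;> simp [hre, him]
end

section
/- Let n₁, n₂, n₃ ∈ ℕ. Let 𝒜₁ = [[A, B], [Bᵗ, D]] be a symmetric positive definite real matrix of size (n₂+n₁) × (n₂+n₁) and 𝒜₂ = [[K, L], [Lᵗ, M]] a symmetric positive definite real matrix of size (n₃+n₂) × (n₃+n₂). Then the diagonal blocks A and M are positive definite, A + M is invertible, and the matrix 𝒜₂∘𝒜₁ = [[K − L(A+M)⁻¹Lᵗ, −L(A+M)⁻¹B], [−Bᵗ(A+M)⁻¹Lᵗ, D − Bᵗ(A+M)⁻¹B]] is a symmetric positive definite real matrix of size (n₃+n₁) × (n₃+n₁). -/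
open Matrix

theorem dotProduct_transpose_mul_mul_mulVec {m p : Type*} [Fintype m] [Fintype p]
    (X : Matrix p p ℝ) (P : Matrix p m ℝ) (v : m → ℝ) :
    star v ⬝ᵥ ((Pᵀ * X * P) *ᵥ v) = star (P *ᵥ v) ⬝ᵥ (X *ᵥ (P *ᵥ v)) := by
  simp [← mulVec_mulVec, dotProduct_mulVec, vecMul_transpose]

/-- A sum of two congruences `Pᵀ X P + Qᵀ Y Q` of positive definite matrices is positive definite
as soon as `P` and `Q` have no common nonzero vector in their kernels. -/
theorem posDef_transpose_mul_mul_add {m p q : Type*} [Fintype m] [Fintype p] [Fintype q]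
    {X : Matrix p p ℝ} {Y : Matrix q q ℝ} (hX : X.PosDef) (hY : Y.PosDef)
    (P : Matrix p m ℝ) (Q : Matrix q m ℝ)
    (hker : ∀ v, P *ᵥ v = 0 → Q *ᵥ v = 0 → v = 0) :
    (Pᵀ * X * P + Qᵀ * Y * Q).PosDef := by
  have hP : (Pᵀ * X * P).PosSemidef := hX.posSemidef.conjTranspose_mul_mul_same P
  have hQ : (Qᵀ * Y * Q).PosSemidef := hY.posSemidef.conjTranspose_mul_mul_same Q
  refine .of_dotProduct_mulVec_pos (hP.add hQ).isHermitian fun v hv => ?_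
  rw [add_mulVec, dotProduct_add]
  by_cases h : P *ᵥ v = 0
  · refine add_pos_of_nonneg_of_pos (hP.dotProduct_mulVec_nonneg v) ?_
    rw [dotProduct_transpose_mul_mul_mulVec]
    exact hY.dotProduct_mulVec_pos fun h' => hv (hker v h h')
  · refine add_pos_of_pos_of_nonneg ?_ (hQ.dotProduct_mulVec_nonneg v)
    rw [dotProduct_transpose_mul_mul_mulVec]
    exact hX.dotProduct_mulVec_pos h

theorem inv_add_mul_mul_inv_add_mul {m k : Type*} [Fintype m] [DecidableEq m]
    (A M : Matrix m m ℝ) (hU : IsUnit (A + M)) (Z : Matrix m k ℝ) :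
    (A + M)⁻¹ * (A * ((A + M)⁻¹ * Z)) =
      (A + M)⁻¹ * Z - (A + M)⁻¹ * (M * ((A + M)⁻¹ * Z)) := by
  rw [eq_sub_iff_add_eq, ← Matrix.mul_add, ← Matrix.add_mul,
    nonsing_inv_mul_cancel_left _ _ ((isUnit_iff_isUnit_det _).mp hU)]

/-- The composition of block matrices as a sum of two congruences. -/
theorem matComp_eq_transpose_mul_mul_add {l m n : Type*} [Fintype l] [Fintype m] [Fintype n]
    [DecidableEq l] [DecidableEq m] [DecidableEq n]
    (A : Matrix m m ℝ) (B : Matrix m l ℝ) (D : Matrix l l ℝ)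
    (K : Matrix n n ℝ) (L : Matrix n m ℝ) (M : Matrix m m ℝ)
    (hS : (A + M).IsSymm) (hU : IsUnit (A + M)) :
    fromBlocks (K - L * (A + M)⁻¹ * Lᵀ) (-(L * (A + M)⁻¹ * B))
      (-(Bᵀ * (A + M)⁻¹ * Lᵀ)) (D - Bᵀ * (A + M)⁻¹ * B) =
    (fromBlocks (1 : Matrix n n ℝ) 0 (-((A + M)⁻¹ * Lᵀ)) (-((A + M)⁻¹ * B)))ᵀ * fromBlocks K L Lᵀ M *
      fromBlocks (1 : Matrix n n ℝ) 0 (-((A + M)⁻¹ * Lᵀ)) (-((A + M)⁻¹ * B)) +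
    (fromBlocks (-((A + M)⁻¹ * Lᵀ)) (-((A + M)⁻¹ * B)) 0 (1 : Matrix l l ℝ))ᵀ * fromBlocks A B Bᵀ D *
      fromBlocks (-((A + M)⁻¹ * Lᵀ)) (-((A + M)⁻¹ * B)) 0 (1 : Matrix l l ℝ) := by
  have hT : ((A + M)⁻¹)ᵀ = (A + M)⁻¹ := by rw [transpose_nonsing_inv, hS.eq]
  simp only [fromBlocks_transpose, fromBlocks_multiply, fromBlocks_add, fromBlocks_inj,
    transpose_neg, transpose_mul, transpose_transpose, transpose_one, transpose_zero, hT,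
    Matrix.mul_assoc, Matrix.add_mul, Matrix.neg_mul, Matrix.mul_neg,
    Matrix.one_mul, Matrix.mul_one, Matrix.zero_mul, Matrix.mul_zero, Matrix.mul_sub,
    inv_add_mul_mul_inv_add_mul A M hU]
  refine ⟨?_, ?_, ?_, ?_⟩ <;> abel

/-- If `𝒜₁ = [[A, B], [Bᵗ, D]]` and `𝒜₂ = [[K, L], [Lᵗ, M]]` are symmetric positive
definite real matrices, then `A` and `M` are positive definite, `A + M` is invertible,
and `𝒜₂∘𝒜₁ = [[K − L(A+M)⁻¹Lᵗ, −L(A+M)⁻¹B], [−Bᵗ(A+M)⁻¹Lᵗ, D − Bᵗ(A+M)⁻¹B]]` is a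
symmetric positive definite real matrix. -/
theorem matComp_posDef (n₁ n₂ n₃ : ℕ)
    (A : Matrix (Fin n₂) (Fin n₂) ℝ) (B : Matrix (Fin n₂) (Fin n₁) ℝ)
    (D : Matrix (Fin n₁) (Fin n₁) ℝ)
    (K : Matrix (Fin n₃) (Fin n₃) ℝ) (L : Matrix (Fin n₃) (Fin n₂) ℝ)
    (M : Matrix (Fin n₂) (Fin n₂) ℝ)
    (h₁ : (Matrix.fromBlocks A B Bᵀ D).PosDef)
    (h₂ : (Matrix.fromBlocks K L Lᵀ M).PosDef) :
    A.PosDef ∧ M.PosDef ∧ IsUnit (A + M) ∧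
    (Matrix.fromBlocks (K - L * (A + M)⁻¹ * Lᵀ) (-(L * (A + M)⁻¹ * B))
      (-(Bᵀ * (A + M)⁻¹ * Lᵀ)) (D - Bᵀ * (A + M)⁻¹ * B)).IsSymm ∧
    (Matrix.fromBlocks (K - L * (A + M)⁻¹ * Lᵀ) (-(L * (A + M)⁻¹ * B))
      (-(Bᵀ * (A + M)⁻¹ * Lᵀ)) (D - Bᵀ * (A + M)⁻¹ * B)).PosDef := by
  have hA : A.PosDef := h₁.submatrix Sum.inl_injective
  have hM : M.PosDef := h₂.submatrix Sum.inr_injective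
  have hAM : (A + M).PosDef := hA.add hM
  have hpos : (fromBlocks (K - L * (A + M)⁻¹ * Lᵀ) (-(L * (A + M)⁻¹ * B))
      (-(Bᵀ * (A + M)⁻¹ * Lᵀ)) (D - Bᵀ * (A + M)⁻¹ * B)).PosDef := by
    rw [matComp_eq_transpose_mul_mul_add A B D K L M hAM.isHermitian hAM.isUnit]
    refine posDef_transpose_mul_mul_add h₂ h₁ _ _ fun v hP hQ => ?_
    ext (i | j)
    · simpa [fromBlocks_mulVec] using congrFun hP (Sum.inl i)
    · simpa [fromBlocks_mulVec] using congrFun hQ (Sum.inr j)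
  exact ⟨hA, hM, hAM.isUnit, hpos.isHermitian, hpos⟩
end

section
/- Let n₁, n₂, n₃, n₄ ∈ ℕ, and let 𝒜₁, 𝒜₂, 𝒜₃ be symmetric positive definite real matrices of sizes (n₂+n₁) × (n₂+n₁), (n₃+n₂) × (n₃+n₂), and (n₄+n₃) × (n₄+n₃) respectively, with the corresponding block decompositions. Then the composition operation ∘ is associative: (𝒜₃ ∘ 𝒜₂) ∘ 𝒜₁ = 𝒜₃ ∘ (𝒜₂ ∘ 𝒜₁). (All compositions are well defined: each relevant sum of diagonal blocks is positive definite, hence invertible, and each composition of symmetric positive definite matrices is again symmetric positive definite.) -/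
open Matrix

/-- The composition `𝒜₂ ∘ 𝒜₁` of block matrices: for `𝒜₁ = [[A,B],[Bᵗ,D]]` and
`𝒜₂ = [[K,L],[Lᵗ,M]]`,
`𝒜₂∘𝒜₁ = [[K − L(A+M)⁻¹Lᵗ, −L(A+M)⁻¹B], [−Bᵗ(A+M)⁻¹Lᵗ, D − Bᵗ(A+M)⁻¹B]]`. -/
noncomputable def matComp {n₁ n₂ n₃ : ℕ}
    (𝒜₂ : Matrix (Fin n₃ ⊕ Fin n₂) (Fin n₃ ⊕ Fin n₂) ℝ)
    (𝒜₁ : Matrix (Fin n₂ ⊕ Fin n₁) (Fin n₂ ⊕ Fin n₁) ℝ) :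
    Matrix (Fin n₃ ⊕ Fin n₁) (Fin n₃ ⊕ Fin n₁) ℝ :=
  Matrix.fromBlocks
    (𝒜₂.toBlocks₁₁ - 𝒜₂.toBlocks₁₂ * (𝒜₁.toBlocks₁₁ + 𝒜₂.toBlocks₂₂)⁻¹ * 𝒜₂.toBlocks₂₁)
    (-(𝒜₂.toBlocks₁₂ * (𝒜₁.toBlocks₁₁ + 𝒜₂.toBlocks₂₂)⁻¹ * 𝒜₁.toBlocks₁₂))
    (-(𝒜₁.toBlocks₂₁ * (𝒜₁.toBlocks₁₁ + 𝒜₂.toBlocks₂₂)⁻¹ * 𝒜₂.toBlocks₂₁))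
    (𝒜₁.toBlocks₂₂ - 𝒜₁.toBlocks₂₁ * (𝒜₁.toBlocks₁₁ + 𝒜₂.toBlocks₂₂)⁻¹ * 𝒜₁.toBlocks₁₂)

namespace Matrix

section SchurComplement

variable {m n R : Type*} [Fintype m] [Fintype n] [DecidableEq m] [DecidableEq n] [CommRing R]
  {P : Matrix n n R} {Q : Matrix m m R} {L : Matrix m n R} {N : Matrix n m R}

/-- The push-through identity for the two Schur complements of `[[Q, L], [N, P]]`. -/
theorem inv_schur_mul_mul_inv (hP : IsUnit P) (hQ : IsUnit Q)
    (hU : IsUnit (Q - L * P⁻¹ * N)) (hV : IsUnit (P - N * Q⁻¹ * L)) :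
    (Q - L * P⁻¹ * N)⁻¹ * L * P⁻¹ = Q⁻¹ * L * (P - N * Q⁻¹ * L)⁻¹ := by
  rw [isUnit_iff_isUnit_det] at hP hQ hU hV
  have key : L * P⁻¹ * (P - N * Q⁻¹ * L) = (Q - L * P⁻¹ * N) * (Q⁻¹ * L) := by
    rw [Matrix.mul_sub, Matrix.sub_mul, nonsing_inv_mul_cancel_right _ _ hP,
      mul_nonsing_inv_cancel_left _ _ hQ]
    simp only [Matrix.mul_assoc]
  calc (Q - L * P⁻¹ * N)⁻¹ * L * P⁻¹
      = (Q - L * P⁻¹ * N)⁻¹ * (L * P⁻¹ * (P - N * Q⁻¹ * L)) * (P - N * Q⁻¹ * L)⁻¹ := by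
        rw [← Matrix.mul_assoc, mul_nonsing_inv_cancel_right _ _ hV, Matrix.mul_assoc]
    _ = Q⁻¹ * L * (P - N * Q⁻¹ * L)⁻¹ := by
        rw [key, nonsing_inv_mul_cancel_left _ _ hU]

/-- The Woodbury identity for the two Schur complements of `[[Q, L], [N, P]]`. -/
theorem inv_schur_eq_add (hP : IsUnit P) (hQ : IsUnit Q)
    (hU : IsUnit (Q - L * P⁻¹ * N)) (hV : IsUnit (P - N * Q⁻¹ * L)) :
    (Q - L * P⁻¹ * N)⁻¹ = Q⁻¹ + Q⁻¹ * L * (P - N * Q⁻¹ * L)⁻¹ * N * Q⁻¹ := by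
  rw [← inv_schur_mul_mul_inv hP hQ hU hV]
  rw [isUnit_iff_isUnit_det] at hQ hU
  have key : (Q - L * P⁻¹ * N)⁻¹ * ((Q - L * P⁻¹ * N) + L * P⁻¹ * N) * Q⁻¹ =
      (Q - L * P⁻¹ * N)⁻¹ := by
    rw [sub_add_cancel, mul_nonsing_inv_cancel_right _ _ hQ]
  rw [Matrix.mul_add, nonsing_inv_mul _ hU, Matrix.add_mul, Matrix.one_mul] at key
  simpa only [Matrix.mul_assoc] using key.symm

end SchurComplement

section PosDef

variable {m n : Type*}

theorem PosDef.toBlocks₁₁ {M : Matrix (m ⊕ n) (m ⊕ n) ℝ} (hM : M.PosDef) :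
    M.toBlocks₁₁.PosDef :=
  hM.submatrix Sum.inl_injective

theorem PosDef.toBlocks₂₂ {M : Matrix (m ⊕ n) (m ⊕ n) ℝ} (hM : M.PosDef) :
    M.toBlocks₂₂.PosDef :=
  hM.submatrix Sum.inr_injective

theorem IsHermitian.conjTranspose_toBlocks₂₁ {M : Matrix (m ⊕ n) (m ⊕ n) ℝ}
    (hM : M.IsHermitian) : M.toBlocks₂₁ᴴ = M.toBlocks₁₂ := by
  ext i j
  exact hM.apply (Sum.inl i) (Sum.inr j)

theorem IsHermitian.conjTranspose_toBlocks₁₂ {M : Matrix (m ⊕ n) (m ⊕ n) ℝ}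
    (hM : M.IsHermitian) : M.toBlocks₁₂ᴴ = M.toBlocks₂₁ := by
  rw [← hM.conjTranspose_toBlocks₂₁, conjTranspose_conjTranspose]

theorem star_dotProduct_conjTranspose_mul_mul_mulVec {k : Type*} [Fintype k] [Fintype m]
    (M : Matrix m m ℝ) (T : Matrix m k ℝ) (v : k → ℝ) :
    star v ⬝ᵥ ((Tᴴ * M * T) *ᵥ v) = star (T *ᵥ v) ⬝ᵥ (M *ᵥ (T *ᵥ v)) := by
  simp only [star_mulVec, dotProduct_mulVec, vecMul_vecMul, Matrix.mul_assoc]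

/-- A sum of two congruences is positive definite if no nonzero vector is killed by both. -/
theorem PosDef.conjTranspose_mul_mul_add {k : Type*} [Fintype k] [Fintype m] [Fintype n]
    {M : Matrix m m ℝ} {N : Matrix n n ℝ} (hM : M.PosDef) (hN : N.PosDef)
    (T : Matrix m k ℝ) (S : Matrix n k ℝ)
    (h : ∀ v, T *ᵥ v = 0 → S *ᵥ v = 0 → v = 0) :
    (Tᴴ * M * T + Sᴴ * N * S).PosDef := by
  have hT := hM.posSemidef.conjTranspose_mul_mul_same T
  have hS := hN.posSemidef.conjTranspose_mul_mul_same S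
  refine .of_dotProduct_mulVec_pos (hT.isHermitian.add hS.isHermitian) fun v hv => ?_
  rw [add_mulVec, dotProduct_add]
  by_cases hTv : T *ᵥ v = 0
  · have hSv : S *ᵥ v ≠ 0 := fun hSv => hv (h v hTv hSv)
    refine add_pos_of_nonneg_of_pos (hT.dotProduct_mulVec_nonneg v) ?_
    rw [star_dotProduct_conjTranspose_mul_mul_mulVec]
    exact hN.dotProduct_mulVec_pos hSv
  · refine add_pos_of_pos_of_nonneg ?_ (hS.dotProduct_mulVec_nonneg v)
    rw [star_dotProduct_conjTranspose_mul_mul_mulVec]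
    exact hM.dotProduct_mulVec_pos hTv

end PosDef

end Matrix

/-- The composition is the sum of `𝒜₂` and `𝒜₁`, with the shared variable eliminated by
minimization. -/
theorem matComp_eq_conjTranspose_mul_mul_add {n₁ n₂ n₃ : ℕ}
    {𝒜₂ : Matrix (Fin n₃ ⊕ Fin n₂) (Fin n₃ ⊕ Fin n₂) ℝ}
    {𝒜₁ : Matrix (Fin n₂ ⊕ Fin n₁) (Fin n₂ ⊕ Fin n₁) ℝ}
    (h₂ : 𝒜₂.IsHermitian) (h₁ : 𝒜₁.IsHermitian)
    (hP : (𝒜₁.toBlocks₁₁ + 𝒜₂.toBlocks₂₂).PosDef) :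
    let P := 𝒜₁.toBlocks₁₁ + 𝒜₂.toBlocks₂₂
    let T : Matrix (Fin n₃ ⊕ Fin n₂) (Fin n₃ ⊕ Fin n₁) ℝ :=
      fromBlocks 1 0 (-(P⁻¹ * 𝒜₂.toBlocks₂₁)) (-(P⁻¹ * 𝒜₁.toBlocks₁₂))
    let S : Matrix (Fin n₂ ⊕ Fin n₁) (Fin n₃ ⊕ Fin n₁) ℝ :=
      fromBlocks (-(P⁻¹ * 𝒜₂.toBlocks₂₁)) (-(P⁻¹ * 𝒜₁.toBlocks₁₂)) 0 1
    matComp 𝒜₂ 𝒜₁ = Tᴴ * 𝒜₂ * T + Sᴴ * 𝒜₁ * S := by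
  intro P T S
  have hunit : IsUnit P.det := (isUnit_iff_isUnit_det P).1 hP.isUnit
  have hPinv : P⁻¹ᴴ = P⁻¹ := hP.inv.isHermitian
  have hL := h₂.conjTranspose_toBlocks₂₁
  have hB := h₁.conjTranspose_toBlocks₁₂
  have cancel {k l : ℕ} (X : Matrix (Fin k) (Fin n₂) ℝ) (Y : Matrix (Fin n₂) (Fin l) ℝ) :
      X * (P⁻¹ * (𝒜₂.toBlocks₂₂ * (P⁻¹ * Y))) + X * (P⁻¹ * (𝒜₁.toBlocks₁₁ * (P⁻¹ * Y))) =
        X * (P⁻¹ * Y) := by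
    rw [← Matrix.mul_add, ← Matrix.mul_add, ← Matrix.add_mul, add_comm,
      mul_nonsing_inv_cancel_left _ _ hunit]
  conv_rhs => rw [← fromBlocks_toBlocks 𝒜₁, ← fromBlocks_toBlocks 𝒜₂]
  simp only [T, S, fromBlocks_conjTranspose, fromBlocks_multiply, fromBlocks_add,
    conjTranspose_neg, conjTranspose_mul, conjTranspose_one, conjTranspose_zero, hPinv, hL, hB,
    Matrix.mul_one, Matrix.one_mul, Matrix.mul_zero, Matrix.zero_mul, add_zero, zero_add,
    Matrix.add_mul, Matrix.neg_mul, Matrix.mul_neg, neg_neg, Matrix.mul_assoc, matComp]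
  congr 1
  · rw [← cancel 𝒜₂.toBlocks₁₂ 𝒜₂.toBlocks₂₁]; abel
  · rw [← cancel 𝒜₂.toBlocks₁₂ 𝒜₁.toBlocks₁₂]; abel
  · rw [← cancel 𝒜₁.toBlocks₂₁ 𝒜₂.toBlocks₂₁]; abel
  · rw [← cancel 𝒜₁.toBlocks₂₁ 𝒜₁.toBlocks₁₂]; abel

theorem Matrix.PosDef.matComp {n₁ n₂ n₃ : ℕ}
    {𝒜₂ : Matrix (Fin n₃ ⊕ Fin n₂) (Fin n₃ ⊕ Fin n₂) ℝ}
    {𝒜₁ : Matrix (Fin n₂ ⊕ Fin n₁) (Fin n₂ ⊕ Fin n₁) ℝ}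
    (h₂ : 𝒜₂.PosDef) (h₁ : 𝒜₁.PosDef) : (matComp 𝒜₂ 𝒜₁).PosDef := by
  rw [matComp_eq_conjTranspose_mul_mul_add h₂.isHermitian h₁.isHermitian
    (h₁.toBlocks₁₁.add h₂.toBlocks₂₂)]
  refine h₂.conjTranspose_mul_mul_add h₁ _ _ fun v hT hS => ?_
  rw [fromBlocks_mulVec] at hT hS
  ext (i | i)
  · simpa using congrFun hT (Sum.inl i)
  · simpa using congrFun hS (Sum.inr i)

/-- For symmetric positive definite `𝒜₁`, `𝒜₂`, `𝒜₃` of the appropriate block sizes, all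
the compositions are well defined (the relevant sums of diagonal blocks are positive
definite, hence invertible, and each composition is again symmetric positive definite)
and the composition is associative: `(𝒜₃ ∘ 𝒜₂) ∘ 𝒜₁ = 𝒜₃ ∘ (𝒜₂ ∘ 𝒜₁)`. -/
theorem matComp_assoc (n₁ n₂ n₃ n₄ : ℕ)
    (𝒜₁ : Matrix (Fin n₂ ⊕ Fin n₁) (Fin n₂ ⊕ Fin n₁) ℝ)
    (𝒜₂ : Matrix (Fin n₃ ⊕ Fin n₂) (Fin n₃ ⊕ Fin n₂) ℝ)
    (𝒜₃ : Matrix (Fin n₄ ⊕ Fin n₃) (Fin n₄ ⊕ Fin n₃) ℝ)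
    (h₁ : 𝒜₁.PosDef) (h₂ : 𝒜₂.PosDef) (h₃ : 𝒜₃.PosDef) :
    (𝒜₁.toBlocks₁₁ + 𝒜₂.toBlocks₂₂).PosDef ∧
    (𝒜₂.toBlocks₁₁ + 𝒜₃.toBlocks₂₂).PosDef ∧
    (matComp 𝒜₂ 𝒜₁).PosDef ∧ (matComp 𝒜₃ 𝒜₂).PosDef ∧
    ((matComp 𝒜₂ 𝒜₁).toBlocks₁₁ + 𝒜₃.toBlocks₂₂).PosDef ∧
    (𝒜₁.toBlocks₁₁ + (matComp 𝒜₃ 𝒜₂).toBlocks₂₂).PosDef ∧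
    matComp (matComp 𝒜₃ 𝒜₂) 𝒜₁ = matComp 𝒜₃ (matComp 𝒜₂ 𝒜₁) := by
  have hP := h₁.toBlocks₁₁.add h₂.toBlocks₂₂
  have hQ := h₂.toBlocks₁₁.add h₃.toBlocks₂₂
  have h₂₁ := h₂.matComp h₁
  have h₃₂ := h₃.matComp h₂
  have hU := h₂₁.toBlocks₁₁.add h₃.toBlocks₂₂
  have hV := h₁.toBlocks₁₁.add h₃₂.toBlocks₂₂
  refine ⟨hP, hQ, h₂₁, h₃₂, hU, hV, ?_⟩
  simp only [matComp, toBlocks_fromBlocks₁₁, toBlocks_fromBlocks₁₂, toBlocks_fromBlocks₂₁,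
    toBlocks_fromBlocks₂₂, sub_add_eq_add_sub, ← add_sub_assoc] at hU hV ⊢
  have hP := hP.isUnit
  have hQ := hQ.isUnit
  have hU := hU.isUnit
  have hV := hV.isUnit
  congr 1
  · rw [inv_schur_eq_add hP hQ hU hV]
    simp only [Matrix.mul_add, Matrix.add_mul, Matrix.neg_mul, Matrix.mul_neg, neg_neg,
      Matrix.mul_assoc, sub_sub]
  · have h := congrArg (fun X => 𝒜₃.toBlocks₁₂ * X * 𝒜₁.toBlocks₁₂)
      (inv_schur_mul_mul_inv hP hQ hU hV)
    simp only [Matrix.mul_assoc] at h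
    simp only [Matrix.neg_mul, Matrix.mul_neg, neg_neg, Matrix.mul_assoc, h]
  · have h := congrArg (fun X => 𝒜₁.toBlocks₂₁ * X * 𝒜₃.toBlocks₂₁)
      (inv_schur_mul_mul_inv hQ hP hV hU)
    simp only [Matrix.mul_assoc] at h
    simp only [Matrix.neg_mul, Matrix.mul_neg, neg_neg, Matrix.mul_assoc, h]
  · rw [inv_schur_eq_add hQ hP hV hU]
    simp only [Matrix.mul_add, Matrix.add_mul, Matrix.neg_mul, Matrix.mul_neg, neg_neg,
      Matrix.mul_assoc, sub_sub]
end

section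
/- For all real numbers a and x, the series ∑_{n=0}^∞ (aⁿ/n!)·hₙ(x) converges with sum e^{ax − a²/2}, where hₙ is the n-th probabilists' Hermite polynomial, i.e. hₙ(x) = (−1)ⁿ e^{x²/2} (dⁿ/dxⁿ) e^{−x²/2}. -/
open Polynomial in
theorem Complex.iteratedDeriv_hermite_generating_function (z : ℂ) (n : ℕ) :
    iteratedDeriv n (fun t : ℂ => Complex.exp (t * z - t ^ 2 / 2)) =
      fun t => aeval (z - t) (hermite n) * Complex.exp (t * z - t ^ 2 / 2) := by
  induction n with
  | zero => simp
  | succ n ih =>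
    rw [iteratedDeriv_succ, ih]
    ext t
    have hexp : HasDerivAt (fun t : ℂ => Complex.exp (t * z - t ^ 2 / 2))
        (Complex.exp (t * z - t ^ 2 / 2) * (z - t)) t := by
      refine HasDerivAt.cexp <| HasDerivAt.congr_deriv
        (((hasDerivAt_id t).mul_const z).fun_sub (((hasDerivAt_id t).fun_pow 2).div_const 2)) ?_
      norm_num
    have hherm : HasDerivAt (fun t : ℂ => aeval (z - t) (hermite n))
        (aeval (z - t) (derivative (hermite n)) * (-1)) t :=
      ((hermite n).hasDerivAt_aeval (z - t)).comp t ((hasDerivAt_id t).const_sub z)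
    rw [(hherm.fun_mul hexp).deriv, hermite_succ, map_sub, map_mul, aeval_X]
    ring

theorem Complex.hasSum_hermite_generating_function (a z : ℂ) :
    HasSum (fun n : ℕ => a ^ n / (Nat.factorial n : ℂ) *
        Polynomial.aeval z (Polynomial.hermite n))
      (Complex.exp (a * z - a ^ 2 / 2)) := by
  have hdiff : Differentiable ℂ fun t : ℂ => Complex.exp (t * z - t ^ 2 / 2) := by fun_prop
  refine (Complex.hasSum_taylorSeries_of_entire hdiff 0 a).congr_fun fun n => ?_
  simp [Complex.iteratedDeriv_hermite_generating_function]
  ring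

/-- Hermite generating function: for all real `a` and `x`, the series
`∑ₙ (aⁿ/n!)·hₙ(x)` converges with sum `e^{ax − a²/2}`, where `hₙ` is the `n`-th
probabilists' Hermite polynomial. -/
theorem hasSum_hermite_generating_function (a x : ℝ) :
    HasSum (fun n : ℕ =>
        a ^ n / (Nat.factorial n : ℝ) *
          (Polynomial.aeval x (Polynomial.hermite n)))
      (Real.exp (a * x - a ^ 2 / 2)) := by
  rw [← Complex.hasSum_ofReal]
  convert Complex.hasSum_hermite_generating_function (a : ℂ) (x : ℂ) using 2 with n
  · have h : Polynomial.aeval (x : ℂ) (Polynomial.hermite n) =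
        ((Polynomial.aeval x (Polynomial.hermite n) : ℝ) : ℂ) :=
      Polynomial.aeval_algebraMap_apply ℂ x _
    push_cast [h]
    rfl
  · push_cast
    rfl
end
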